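/- Let R be a polynomial with real coefficients of degree N ≥ 2 such that R(0) = 0, c := R'(0) > 1, and there exists a > 0 with the property that every complex number z with R(z) ∈ [0,a] satisfies z ∈ [0,a]. Fix z₀ ∈ [0,a] and set d_R := 2·log N / log c. Then ζ_{z₀,R} always has a pole at s = d_R in the following sense: there is no open neighborhood U of d_R in ℂ and holomorphic function h on U such that h(s) = ζ_{z₀,R}(s) for all s ∈ U with Re(s) > d_R. -/

import Mathlib

open Polynomial Filter

/-- The `n`-fold composition `R^{∘n}` of a polynomial, with `R^{∘0} = X`. -/
noncomputable def polyIter (R : Polynomial ℝ) : ℕ → Polynomial ℝ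
  | 0 => Polynomial.X
  | n + 1 => R.comp (polyIter R n)

/-- The multiset `R^{-n}{z₀}` of complex roots (with multiplicity) of `R^{∘n}(z) - z₀`. -/
noncomputable def preimageRoots (R : Polynomial ℝ) (z₀ : ℝ) (n : ℕ) : Multiset ℂ :=
  ((polyIter R n - Polynomial.C z₀).map (algebraMap ℝ ℂ)).roots

/-- The partial sum `Σ_{z ∈ R^{-n}{z₀}, z ≠ 0} (cⁿ z)^{-s/2}`. -/
noncomputable def zetaPartial (R : Polynomial ℝ) (c z₀ : ℝ) (n : ℕ) (s : ℂ) : ℂ :=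
  ((preimageRoots R z₀ n).map
    (fun z => if z = 0 then 0 else ((c : ℂ) ^ n * z) ^ (-s / 2))).sum

/-- Membership of a complex number in the real interval `[0, a]`. -/
def memIcc (a : ℝ) (z : ℂ) : Prop := z.im = 0 ∧ z.re ∈ Set.Icc 0 a

/-! ### Power sums of reciprocals of roots -/

lemma coeff_prod_one_sub {F : Type*} [Field F] (s : Multiset F) :
    (s.map fun u => 1 - C u * X).prod.coeff 0 = 1 ∧
    (s.map fun u => 1 - C u * X).prod.coeff 1 = -s.sum ∧
    2 * (s.map fun u => 1 - C u * X).prod.coeff 2 = s.sum ^ 2 - (s.map (· ^ 2)).sum := by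
  induction s using Multiset.induction_on with
  | empty => simp [coeff_one]
  | cons u s ih =>
    obtain ⟨h0, h1, h2⟩ := ih
    simp only [Multiset.map_cons, Multiset.prod_cons, Multiset.sum_cons]
    set P := (s.map fun u => 1 - C u * X).prod
    have e : (1 - C u * X) * P = P - C u * (X * P) := by ring
    rw [e]
    refine ⟨by simp [h0], by simp [h0, h1, coeff_X_mul P 0]; ring, ?_⟩
    simp only [coeff_sub, coeff_C_mul, coeff_X_mul P 1]
    linear_combination h2 - 2 * u * h1

lemma prod_X_sub_C_eq {F : Type*} [Field F] (s : Multiset F) (hs : (0 : F) ∉ s) :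
    (s.map fun w => X - C w).prod =
      C (s.map fun w => -w).prod * ((s.map (·⁻¹)).map fun u => 1 - C u * X).prod := by
  induction s using Multiset.induction_on with
  | empty => simp
  | cons u s ih =>
    simp only [Multiset.mem_cons, not_or] at hs
    simp only [Multiset.map_cons, Multiset.prod_cons, ih hs.2, C_mul]
    have hu : C u * C u⁻¹ = 1 := by rw [← C_mul, mul_inv_cancel₀ (Ne.symm hs.1), C_1]
    have : X - C u = C (-u) * (1 - C u⁻¹ * X) := by
      rw [C_neg]
      linear_combination (-X) * hu
    rw [this]
    ring

lemma sum_inv_roots {F : Type*} [Field F] [IsAlgClosed F] (p : F[X]) (hp : p.coeff 0 ≠ 0) :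
    (p.roots.map (·⁻¹)).sum * p.coeff 0 = -p.coeff 1 ∧
    (p.roots.map (fun w => w⁻¹ ^ 2)).sum * p.coeff 0 ^ 2 =
      p.coeff 1 ^ 2 - 2 * p.coeff 2 * p.coeff 0 := by
  have h0 : (0 : F) ∉ p.roots := by
    intro h
    exact hp (by rw [coeff_zero_eq_eval_zero]; exact isRoot_of_mem_roots h)
  obtain ⟨c0, c1, c2⟩ := coeff_prod_one_sub (p.roots.map (·⁻¹))
  have hfac := (IsAlgClosed.splits p).eq_prod_roots
  rw [prod_X_sub_C_eq _ h0, ← mul_assoc, ← C_mul] at hfac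
  set Q := ((p.roots.map (·⁻¹)).map fun u => 1 - C u * X).prod
  set b := p.leadingCoeff * (p.roots.map fun w => -w).prod
  have k : ∀ i, p.coeff i = b * Q.coeff i := fun i => by
    conv_lhs => rw [hfac]
    rw [coeff_C_mul]
  rw [Multiset.map_map] at c2
  simp only [Function.comp_def] at c2
  rw [k 0, k 1, k 2, c0, c1]
  refine ⟨by ring, ?_⟩
  linear_combination (b ^ 2) * c2

/-! ### Iterates and their preimages -/

lemma polyIter_add (R : ℝ[X]) (m k : ℕ) :
    polyIter R (m + k) = (polyIter R m).comp (polyIter R k) := by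
  induction m with
  | zero => simp [polyIter]
  | succ m ih => rw [Nat.succ_add, polyIter, polyIter, ih, comp_assoc]

lemma eval_zero_polyIter {R : ℝ[X]} (hR0 : R.eval 0 = 0) (k : ℕ) :
    (polyIter R k).eval 0 = 0 := by
  induction k with
  | zero => simp [polyIter]
  | succ k ih => simp [polyIter, eval_comp, ih, hR0]

lemma coeff_one_polyIter {R : ℝ[X]} (hR0 : R.eval 0 = 0) (k : ℕ) :
    (polyIter R k).coeff 1 = (R.derivative.eval 0) ^ k := by
  have : ∀ p : ℝ[X], p.coeff 1 = p.derivative.eval 0 := fun p => by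
    rw [← coeff_zero_eq_eval_zero, coeff_derivative]; simp
  rw [this]
  induction k with
  | zero => simp [polyIter]
  | succ k ih =>
    simp [polyIter, derivative_comp, eval_comp, ih, eval_zero_polyIter hR0, pow_succ]

lemma natDegree_polyIter (R : ℝ[X]) (k : ℕ) :
    (polyIter R k).natDegree = R.natDegree ^ k := by
  induction k with
  | zero => simp [polyIter]
  | succ k ih => rw [polyIter, natDegree_comp, ih, pow_succ']

lemma natDegree_polyIter_sub_C (R : ℝ[X]) (y : ℝ) (k : ℕ) :
    ((polyIter R k - C y).map (algebraMap ℝ ℂ)).natDegree = R.natDegree ^ k := by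
  rw [natDegree_map, natDegree_sub_C, natDegree_polyIter]

lemma polyIter_sub_C_ne_zero {R : ℝ[X]} (hN : 2 ≤ R.natDegree) (y : ℝ) (k : ℕ) :
    (polyIter R k - C y).map (algebraMap ℝ ℂ) ≠ 0 := by
  intro h
  have := natDegree_polyIter_sub_C R y k
  rw [h, natDegree_zero] at this
  exact (pow_pos (by omega : 0 < R.natDegree) k).ne this

lemma card_preimageRoots (R : ℝ[X]) (y : ℝ) (k : ℕ) :
    (preimageRoots R y k).card = R.natDegree ^ k := by
  rw [preimageRoots, ← (IsAlgClosed.splits _).natDegree_eq_card_roots, natDegree_polyIter_sub_C]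

lemma aeval_of_mem_preimageRoots {R : ℝ[X]} {y : ℝ} {k : ℕ} {w : ℂ}
    (hw : w ∈ preimageRoots R y k) : aeval w (polyIter R k) = (y : ℂ) := by
  have := isRoot_of_mem_roots hw
  rw [IsRoot.def, eval_map_algebraMap] at this
  simpa [sub_eq_zero] using this

lemma memIcc_of_aeval_polyIter {R : ℝ[X]} {a : ℝ}
    (hinv : ∀ z : ℂ, memIcc a (aeval z R) → memIcc a z) (k : ℕ) (w : ℂ)
    (hw : memIcc a (aeval w (polyIter R k))) : memIcc a w := by
  induction k with
  | zero => simpa [polyIter] using hw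
  | succ k ih =>
    rw [polyIter, aeval_comp] at hw
    exact ih (hinv _ hw)

lemma memIcc_of_mem_preimageRoots {R : ℝ[X]} {a : ℝ}
    (hinv : ∀ z : ℂ, memIcc a (aeval z R) → memIcc a z) {y : ℝ} (hy : y ∈ Set.Icc 0 a)
    {k : ℕ} {w : ℂ} (hw : w ∈ preimageRoots R y k) : memIcc a w := by
  refine memIcc_of_aeval_polyIter hinv k w ?_
  rw [aeval_of_mem_preimageRoots hw]
  exact ⟨by simp, by simpa using hy⟩

lemma memIcc.ofReal_re {a : ℝ} {z : ℂ} (h : memIcc a z) : ((z.re : ℝ) : ℂ) = z :=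
  Complex.ext (by simp) (by simp [h.1])

lemma ne_zero_of_mem_preimageRoots {R : ℝ[X]} (hR0 : R.eval 0 = 0) {y : ℝ} (hy : y ≠ 0)
    {k : ℕ} {w : ℂ} (hw : w ∈ preimageRoots R y k) : w ≠ 0 := by
  rintro rfl
  have := aeval_of_mem_preimageRoots hw
  rw [← coeff_zero_eq_aeval_zero', coeff_zero_eq_eval_zero, eval_zero_polyIter hR0] at this
  exact hy (by simpa using this.symm)

lemma re_pos_of_mem_preimageRoots {R : ℝ[X]} {a : ℝ} (hR0 : R.eval 0 = 0)
    (hinv : ∀ z : ℂ, memIcc a (aeval z R) → memIcc a z) {y : ℝ} (hy : y ∈ Set.Ioc 0 a)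
    {k : ℕ} {w : ℂ} (hw : w ∈ preimageRoots R y k) : 0 < w.re := by
  have h := memIcc_of_mem_preimageRoots hinv (Set.Ioc_subset_Icc_self hy) hw
  refine lt_of_le_of_ne h.2.1 fun h0 => ne_zero_of_mem_preimageRoots hR0 hy.1.ne' hw ?_
  rw [← h.ofReal_re, ← h0, Complex.ofReal_zero]

lemma preimageRoots_power_sums {R : ℝ[X]} {a : ℝ} (hR0 : R.eval 0 = 0)
    (hinv : ∀ z : ℂ, memIcc a (aeval z R) → memIcc a z) {y : ℝ} (hy : y ∈ Set.Ioc 0 a) (k : ℕ) :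
    ((preimageRoots R y k).map fun w => w.re⁻¹).sum = (R.derivative.eval 0) ^ k / y ∧
    ((preimageRoots R y k).map fun w => w.re⁻¹ ^ 2).sum =
      ((R.derivative.eval 0) ^ k / y) ^ 2 + 2 * (polyIter R k).coeff 2 / y := by
  have hy0 : (y : ℂ) ≠ 0 := by exact_mod_cast hy.1.ne'
  have hre : ∀ w ∈ preimageRoots R y k, ((w.re : ℝ) : ℂ) = w := fun w hw =>
    (memIcc_of_mem_preimageRoots hinv (Set.Ioc_subset_Icc_self hy) hw).ofReal_re
  have hc0 : ((polyIter R k - C y).map (algebraMap ℝ ℂ)).coeff 0 = -(y : ℂ) := by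
    rw [coeff_map, coeff_sub, coeff_zero_eq_eval_zero, eval_zero_polyIter hR0]; simp
  have hc1 : ((polyIter R k - C y).map (algebraMap ℝ ℂ)).coeff 1 =
      ((R.derivative.eval 0 ^ k : ℝ) : ℂ) := by
    rw [coeff_map, coeff_sub, coeff_one_polyIter hR0]; simp
  have hc2 : ((polyIter R k - C y).map (algebraMap ℝ ℂ)).coeff 2 =
      (((polyIter R k).coeff 2 : ℝ) : ℂ) := by
    simp
  obtain ⟨h1, h2⟩ := sum_inv_roots ((polyIter R k - C y).map (algebraMap ℝ ℂ))
    (by rw [hc0]; exact neg_ne_zero.2 hy0)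
  rw [hc0, hc1] at h1
  rw [hc0, hc1, hc2] at h2
  have e1 : (((((preimageRoots R y k).map fun w => w.re⁻¹).sum : ℝ)) : ℂ) =
      ((preimageRoots R y k).map (·⁻¹)).sum := by
    rw [← Complex.ofRealHom_eq_coe, map_multiset_sum, Multiset.map_map]
    congr 1
    refine Multiset.map_congr rfl fun w hw => ?_
    simp [hre w hw]
  have e2 : (((((preimageRoots R y k).map fun w => w.re⁻¹ ^ 2).sum : ℝ)) : ℂ) =
      ((preimageRoots R y k).map (fun w => w⁻¹ ^ 2)).sum := by
    rw [← Complex.ofRealHom_eq_coe, map_multiset_sum, Multiset.map_map]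
    congr 1
    refine Multiset.map_congr rfl fun w hw => ?_
    simp [hre w hw]
  have hy' := hy.1.ne'
  rw [← preimageRoots, ← e1] at h1
  rw [← preimageRoots, ← e2] at h2
  norm_cast at h1 h2
  generalize ((preimageRoots R y k).map fun w => w.re⁻¹).sum = S₁ at h1 ⊢
  generalize ((preimageRoots R y k).map fun w => w.re⁻¹ ^ 2).sum = S₂ at h2 ⊢
  constructor
  · field_simp
    linarith
  · field_simp
    linear_combination h2

lemma mem_preimageRoots {R : ℝ[X]} (hN : 2 ≤ R.natDegree) {y : ℝ} {k : ℕ} {w : ℂ} :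
    w ∈ preimageRoots R y k ↔ aeval w (polyIter R k) = (y : ℂ) := by
  refine ⟨aeval_of_mem_preimageRoots, fun h => ?_⟩
  rw [preimageRoots, mem_roots (polyIter_sub_C_ne_zero hN y k), IsRoot.def, eval_map_algebraMap]
  simp [h]

lemma preimageRoots_ne_empty {R : ℝ[X]} (hN : 2 ≤ R.natDegree) (y : ℝ) (k : ℕ) :
    preimageRoots R y k ≠ ∅ := by
  intro h
  have := card_preimageRoots R y k
  rw [h, Multiset.empty_eq_zero, Multiset.card_zero] at this
  exact (pow_pos (by omega : 0 < R.natDegree) k).ne this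

lemma natDegree_lt_derivative {R : ℝ[X]} {a : ℝ} (hN : 2 ≤ R.natDegree) (hR0 : R.eval 0 = 0)
    (ha : 0 < a) (hinv : ∀ z : ℂ, memIcc a (aeval z R) → memIcc a z) :
    (R.natDegree : ℝ) < R.derivative.eval 0 := by
  have haI : a ∈ Set.Ioc 0 a := ⟨ha, le_rfl⟩
  have hI : ∀ w ∈ preimageRoots R a 1, 0 < w.re ∧ w.re ≤ a := fun w hw =>
    ⟨re_pos_of_mem_preimageRoots hR0 hinv haI hw,
      (memIcc_of_mem_preimageRoots hinv (Set.Ioc_subset_Icc_self haI) hw).2.2⟩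
  by_cases hall : ∀ w ∈ preimageRoots R a 1, w = (a : ℂ)
  · exfalso
    set P : ℂ[X] := (polyIter R 1 - C a).map (algebraMap ℝ ℂ) with hP
    have hrep : P.roots = Multiset.replicate R.natDegree (a : ℂ) := by
      rw [Multiset.eq_replicate]
      exact ⟨(card_preimageRoots R a 1).trans (pow_one _), hall⟩
    have hfac : P = C P.leadingCoeff * (X - C (a : ℂ)) ^ R.natDegree := by
      have := (IsAlgClosed.splits P).eq_prod_roots
      rw [hrep] at this
      simpa using this
    have hev : ∀ z : ℂ, aeval z R - a = P.leadingCoeff * (z - a) ^ R.natDegree := fun z => by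
      have := congrArg (eval z) hfac
      rw [hP, eval_map_algebraMap, ← hP] at this
      simpa [polyIter] using this
    have h0 : aeval (0 : ℂ) R = 0 := by
      rw [← coeff_zero_eq_aeval_zero', coeff_zero_eq_eval_zero, hR0]; simp
    have hprim := Complex.isPrimitiveRoot_exp R.natDegree (by omega)
    set ω := Complex.exp (2 * Real.pi * Complex.I / R.natDegree)
    have hz : aeval ((a : ℂ) - a * ω) R = 0 := by
      have e1 := hev 0
      have e2 := hev ((a : ℂ) - a * ω)
      have e3 : (a : ℂ) - a * ω - a = (0 - a) * ω := by ring
      rw [e3, mul_pow, hprim.pow_eq_one, mul_one, ← e1, h0] at e2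
      linear_combination e2
    have hmem := hinv _ (by rw [hz]; exact ⟨by simp, by simp [ha.le]⟩)
    have him : ω.im = 0 := by
      have := hmem.1
      simpa [ha.ne'] using this
    have hre : 0 ≤ ω.re := by
      have := hmem.2.2
      simp only [Complex.sub_re, Complex.ofReal_re, Complex.mul_re, Complex.ofReal_im, zero_mul,
        sub_zero, tsub_le_iff_right, le_add_iff_nonneg_right] at this
      exact nonneg_of_mul_nonneg_right this ha
    have hω : ω = (ω.re : ℂ) := Complex.ext (by simp) (by simp [him])
    have h1 : ω.re ^ R.natDegree = 1 := by
      have := hprim.pow_eq_one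
      rw [hω] at this
      exact_mod_cast this
    have h2 := (pow_eq_one_iff_of_nonneg hre (by omega)).1 h1
    exact hprim.ne_one (by omega) (by rw [hω, h2, Complex.ofReal_one])
  · push Not at hall
    obtain ⟨w, hw, hwa⟩ := hall
    have hlt : w.re < a := lt_of_le_of_ne (hI w hw).2 fun h => hwa <| by
      rw [← h]
      exact (memIcc_of_mem_preimageRoots hinv (Set.Ioc_subset_Icc_self haI) hw).ofReal_re.symm
    have hs := Multiset.sum_lt_sum (s := preimageRoots R a 1) (f := fun _ => a⁻¹)
      (g := fun w => w.re⁻¹) (fun w hw => inv_anti₀ (hI w hw).1 (hI w hw).2)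
      ⟨w, hw, inv_strictAnti₀ (hI w hw).1 hlt⟩
    rw [(preimageRoots_power_sums hR0 hinv haI 1).1] at hs
    simp only [Multiset.map_const', Multiset.sum_replicate, card_preimageRoots, pow_one,
      nsmul_eq_mul, ← div_eq_mul_inv] at hs
    exact (div_lt_div_iff_of_pos_right ha).1 hs

lemma exists_preimage_le {R : ℝ[X]} {a : ℝ} (hN : 2 ≤ R.natDegree) (hR0 : R.eval 0 = 0)
    (hc : 0 < R.derivative.eval 0) (ha : 0 < a)
    (hinv : ∀ z : ℂ, memIcc a (aeval z R) → memIcc a z) {y : ℝ} (hy : y ∈ Set.Ioo 0 a) (k : ℕ) :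
    ∃ w ∈ preimageRoots R y k, (R.derivative.eval 0) ^ k * w.re * (1 - y / a) ≤ y := by
  by_contra! hcon
  set b := (R.derivative.eval 0) ^ k with hb
  have hbpos : 0 < b := pow_pos hc k
  have hyI : y ∈ Set.Ioc 0 a := Set.Ioo_subset_Ioc_self hy
  obtain ⟨hy0, hya⟩ := hy
  obtain ⟨s1, s2⟩ := preimageRoots_power_sums hR0 hinv hyI k
  have s3 := (preimageRoots_power_sums hR0 hinv (⟨ha, le_rfl⟩ : a ∈ Set.Ioc 0 a) k).2
  rw [← hb] at s1 s2 s3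
  have hnn : 0 ≤ (b / a) ^ 2 + 2 * (polyIter R k).coeff 2 / a := by
    rw [← s3]
    refine Multiset.sum_nonneg fun x hx => ?_
    obtain ⟨w, -, rfl⟩ := Multiset.mem_map.1 hx
    positivity
  have hpos : 0 < 1 - y / a := by rw [sub_pos, div_lt_one ha]; exact hya
  have hs := Multiset.sum_lt_sum_of_nonempty (s := preimageRoots R y k)
    (f := fun w => w.re⁻¹ ^ 2) (g := fun w => w.re⁻¹ * (b / y * (1 - y / a)))
    (preimageRoots_ne_empty hN y k) fun w hw => by
      have hw0 := re_pos_of_mem_preimageRoots hR0 hinv hyI hw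
      have := hcon w hw
      rw [sq]
      refine mul_lt_mul_of_pos_left ?_ (inv_pos.2 hw0)
      rw [inv_lt_iff_one_lt_mul₀ hw0, div_mul_eq_mul_div, div_mul_eq_mul_div, one_lt_div hy0]
      linarith
  rw [s2, Multiset.sum_map_mul_right, s1] at hs
  have h1 : 0 ≤ b ^ 2 / a + 2 * (polyIter R k).coeff 2 := by
    have := mul_nonneg hnn ha.le
    have e : ((b / a) ^ 2 + 2 * (polyIter R k).coeff 2 / a) * a =
      b ^ 2 / a + 2 * (polyIter R k).coeff 2 := by field_simp
    rwa [e] at this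
  have h2 := div_nonneg h1 hy0.le
  have e : b / y * (b / y * (1 - y / a)) = (b / y) ^ 2 - b ^ 2 / a / y := by field_simp
  rw [e] at hs
  rw [add_div] at h2
  linarith

lemma exists_preimage_one_le {R : ℝ[X]} {a : ℝ} (hN : 2 ≤ R.natDegree) (hR0 : R.eval 0 = 0)
    (hc : 0 < R.derivative.eval 0)
    (hinv : ∀ z : ℂ, memIcc a (aeval z R) → memIcc a z) {y : ℝ} (hy : y ∈ Set.Ioc 0 a) :
    ∃ w ∈ preimageRoots R y 1, w.re ≤ R.natDegree / R.derivative.eval 0 * y := by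
  by_contra! hcon
  have hy0 := hy.1
  have hN0 : (0 : ℝ) < R.natDegree := by exact_mod_cast (by omega : 0 < R.natDegree)
  have hs := Multiset.sum_lt_sum_of_nonempty (s := preimageRoots R y 1)
    (f := fun w => w.re⁻¹) (g := fun _ => (R.natDegree / R.derivative.eval 0 * y)⁻¹)
    (preimageRoots_ne_empty hN y 1) fun w hw => inv_strictAnti₀ (by positivity) (hcon w hw)
  rw [(preimageRoots_power_sums hR0 hinv hy 1).1] at hs
  simp only [Multiset.map_const', Multiset.sum_replicate, card_preimageRoots, pow_one,
    nsmul_eq_mul] at hs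
  refine hs.ne ?_
  field_simp

lemma exists_uniform_preimage_le {R : ℝ[X]} {a : ℝ} (hN : 2 ≤ R.natDegree) (hR0 : R.eval 0 = 0)
    (hc : 1 < R.derivative.eval 0) (ha : 0 < a)
    (hinv : ∀ z : ℂ, memIcc a (aeval z R) → memIcc a z) :
    ∃ K > 0, ∀ k, ∀ y ∈ Set.Ioc 0 a, ∃ w ∈ preimageRoots R y k,
      (R.derivative.eval 0) ^ k * w.re ≤ K := by
  have hlt := natDegree_lt_derivative hN hR0 ha hinv
  set c := R.derivative.eval 0
  have hc0 : 0 < c := by linarith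
  have hN0 : (0 : ℝ) < R.natDegree := by exact_mod_cast (by omega : 0 < R.natDegree)
  set θ := R.natDegree / c
  have hθ : θ < 1 := (div_lt_one hc0).2 hlt
  have hθ0 : 0 < θ := by positivity
  have hK : 0 < c * a / (1 - θ) := div_pos (by positivity) (by linarith)
  refine ⟨c * a / (1 - θ), hK, fun k y hy => ?_⟩
  cases k with
  | zero =>
    obtain ⟨w, hw⟩ := Multiset.exists_mem_of_ne_zero (preimageRoots_ne_empty hN y 0)
    refine ⟨w, hw, ?_⟩
    have := (memIcc_of_mem_preimageRoots hinv (Set.Ioc_subset_Icc_self hy) hw).2.2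
    rw [pow_zero, one_mul, le_div_iff₀ (by linarith)]
    nlinarith
  | succ k =>
    obtain ⟨v, hv, hvle⟩ := exists_preimage_one_le hN hR0 hc0 hinv hy
    have hv0 := re_pos_of_mem_preimageRoots hR0 hinv hy hv
    have hvθ : v.re ≤ θ * a := hvle.trans (mul_le_mul_of_nonneg_left hy.2 hθ0.le)
    have hva : v.re < a := by nlinarith
    obtain ⟨w, hw, hwle⟩ := exists_preimage_le hN hR0 hc0 ha hinv ⟨hv0, hva⟩ k
    have hw0 := re_pos_of_mem_preimageRoots hR0 hinv ⟨hv0, hva.le⟩ hw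
    refine ⟨w, ?_, ?_⟩
    · rw [mem_preimageRoots hN] at hw hv ⊢
      rw [polyIter, aeval_comp, hw, (memIcc_of_mem_preimageRoots hinv (Set.Ioc_subset_Icc_self hy)
        ((mem_preimageRoots hN).2 hv)).ofReal_re]
      simpa [polyIter] using hv
    · rw [le_div_iff₀ (by linarith)]
      have h1 : v.re / a ≤ θ := (div_le_iff₀ ha).2 hvθ
      have h2 : c ^ k * w.re * (1 - θ) ≤ c ^ k * w.re * (1 - v.re / a) :=
        mul_le_mul_of_nonneg_left (by linarith) (by positivity)
      calc c ^ (k + 1) * w.re * (1 - θ) = c * (c ^ k * w.re * (1 - θ)) := by ring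
        _ ≤ c * a := mul_le_mul_of_nonneg_left (by linarith) hc0.le

lemma preimageRoots_add {R : ℝ[X]} {a : ℝ} (hN : 2 ≤ R.natDegree)
    (hinv : ∀ z : ℂ, memIcc a (aeval z R) → memIcc a z) {y : ℝ} (hy : y ∈ Set.Icc 0 a)
    (m k : ℕ) :
    preimageRoots R y (m + k) = (preimageRoots R y m).bind fun z => preimageRoots R z.re k := by
  set P : ℂ[X] := (polyIter R m - C y).map (algebraMap ℝ ℂ) with hP
  set Q : ℂ[X] := (polyIter R k).map (algebraMap ℝ ℂ) with hQ
  have hcomp : (polyIter R (m + k) - C y).map (algebraMap ℝ ℂ) = P.comp Q := by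
    rw [hP, hQ, ← map_comp, polyIter_add, sub_comp, C_comp]
  have hfac : P.comp Q = C P.leadingCoeff * (P.roots.map fun z => Q - C z).prod := by
    conv_lhs => rw [(IsAlgClosed.splits P).eq_prod_roots]
    rw [mul_comp, C_comp, multiset_prod_comp, Multiset.map_map]
    simp
  have hre : ∀ z ∈ P.roots,
      Q - C z = (polyIter R k - C z.re).map (algebraMap ℝ ℂ) := fun z hz => by
    have := (memIcc_of_mem_preimageRoots hinv hy (k := m) hz).ofReal_re
    simp [hQ, this]
  rw [Multiset.map_congr rfl hre] at hfac
  rw [preimageRoots, hcomp, hfac, roots_C_mul _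
    (leadingCoeff_ne_zero.2 (polyIter_sub_C_ne_zero hN y m)), roots_multiset_prod,
    Multiset.bind_map]
  · rfl
  · intro h
    obtain ⟨z, -, hz⟩ := Multiset.mem_map.1 h
    exact polyIter_sub_C_ne_zero hN _ _ hz

lemma count_zero_preimageRoots_le {R : ℝ[X]} (hN : 2 ≤ R.natDegree) (hR0 : R.eval 0 = 0)
    (hc : R.derivative.eval 0 ≠ 0) (y : ℝ) (m : ℕ) : (preimageRoots R y m).count 0 ≤ 1 := by
  rw [preimageRoots, count_roots]
  by_contra! h
  have := ((one_lt_rootMultiplicity_iff_isRoot (polyIter_sub_C_ne_zero hN y m)).1 h).2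
  rw [IsRoot.def, ← coeff_zero_eq_eval_zero, coeff_derivative, coeff_map, coeff_sub, zero_add,
    coeff_one_polyIter hR0] at this
  simp [hc] at this

/-- The nonzero points of `R^{-n}{y}`, multiplied by `cⁿ`. -/
noncomputable def scaledPreimages (R : ℝ[X]) (c y : ℝ) (n : ℕ) : Multiset ℝ :=
  ((preimageRoots R y n).filter fun w => 0 < w.re).map fun w => c ^ n * w.re

lemma pos_of_mem_scaledPreimages {R : ℝ[X]} {c y : ℝ} (hc : 0 < c) {n : ℕ} {x : ℝ}
    (hx : x ∈ scaledPreimages R c y n) : 0 < x := by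
  obtain ⟨w, hw, rfl⟩ := Multiset.mem_map.1 hx
  exact mul_pos (pow_pos hc n) (Multiset.mem_filter.1 hw).2

lemma exists_le_card_scaledPreimages {R : ℝ[X]} {a : ℝ} (hN : 2 ≤ R.natDegree)
    (hR0 : R.eval 0 = 0) (hc : 1 < R.derivative.eval 0) (ha : 0 < a)
    (hinv : ∀ z : ℂ, memIcc a (aeval z R) → memIcc a z) {y : ℝ} (hy : y ∈ Set.Icc 0 a) :
    ∃ K > 0, ∀ n, ∀ m ≤ n, R.natDegree ^ m ≤
      ((scaledPreimages R (R.derivative.eval 0) y n).filter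
        (· ≤ (R.derivative.eval 0) ^ m * K)).card + 1 := by
  obtain ⟨K, hK, hex⟩ := exists_uniform_preimage_le hN hR0 hc ha hinv
  refine ⟨K, hK, fun n m hmn => ?_⟩
  obtain ⟨k, rfl⟩ := Nat.exists_eq_add_of_le hmn
  set c := R.derivative.eval 0
  have hc0 : 0 < c := by linarith
  rw [scaledPreimages, Multiset.filter_map, Multiset.card_map, Multiset.filter_filter,
    preimageRoots_add hN hinv hy, Multiset.filter_bind, Multiset.card_bind]
  have hle : ((preimageRoots R y m).map fun z => if z = 0 then 0 else 1).sum ≤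
      ((preimageRoots R y m).map (Multiset.card ∘ fun z => (preimageRoots R z.re k).filter
        fun w => ((· ≤ c ^ m * K) ∘ fun w : ℂ => c ^ (m + k) * w.re) w ∧ 0 < w.re)).sum := by
    refine Multiset.sum_map_le_sum_map _ _ fun z hz => ?_
    split_ifs with h
    · exact Nat.zero_le _
    · have hzI := memIcc_of_mem_preimageRoots hinv hy hz
      have hz' : z.re ∈ Set.Ioc 0 a := ⟨lt_of_le_of_ne hzI.2.1 fun h0 => h <| by
        rw [← hzI.ofReal_re, ← h0, Complex.ofReal_zero], hzI.2.2⟩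
      obtain ⟨w, hw, hwK⟩ := hex k z.re hz'
      refine Nat.succ_le_of_lt (Multiset.card_pos_iff_exists_mem.2
        ⟨w, Multiset.mem_filter.2 ⟨hw, ?_, re_pos_of_mem_preimageRoots hR0 hinv hz' hw⟩⟩)
      simp only [Function.comp_apply, pow_add, mul_assoc]
      exact mul_le_mul_of_nonneg_left hwK (by positivity)
  refine le_trans ?_ (Nat.add_le_add_right hle 1)
  have hcount : ∀ s : Multiset ℂ,
      s.card = (s.map fun z => if z = 0 then 0 else 1).sum + s.count 0 := fun s => by
    induction s using Multiset.induction_on with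
    | empty => simp
    | cons z s ih =>
      by_cases h : z = 0
      · simp [h, ih, add_assoc]
      · simp [h, ih, Multiset.count_cons_of_ne (Ne.symm h)]; ring
  rw [← card_preimageRoots R y m, hcount]
  exact Nat.add_le_add_left (count_zero_preimageRoots_le hN hR0 hc0.ne' y m) _

/-! ### Divergence at the critical exponent -/

lemma sum_filter_rpow_le {s : Multiset ℝ} (hs : ∀ x ∈ s, 0 < x) (p : ℝ → Prop) [DecidablePred p]
    (t : ℝ) : ((s.filter p).map (· ^ t)).sum ≤ (s.map (· ^ t)).sum := by
  conv_rhs => rw [← Multiset.filter_add_not p s, Multiset.map_add, Multiset.sum_add]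
  refine le_add_of_nonneg_right (Multiset.sum_nonneg fun y hy => ?_)
  obtain ⟨x, hx, rfl⟩ := Multiset.mem_map.1 hy
  exact Real.rpow_nonneg (hs x (Multiset.mem_filter.1 hx).1).le t

lemma card_mul_rpow_le_sum {s : Multiset ℝ} (hs : ∀ x ∈ s, 0 < x) {X t : ℝ} (ht : t ≤ 0)
    (hX : ∀ x ∈ s, x ≤ X) : s.card * X ^ t ≤ (s.map (· ^ t)).sum := by
  have := Multiset.card_nsmul_le_sum (s := s.map (· ^ t)) (a := X ^ t) fun y hy => by
    obtain ⟨x, hx, rfl⟩ := Multiset.mem_map.1 hy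
    exact Real.rpow_le_rpow_of_nonpos (hs x hx) (hX x hx) ht
  simpa using this

lemma not_tendsto_of_card_ge {Λ : ℕ → Multiset ℝ} (hpos : ∀ n, ∀ x ∈ Λ n, 0 < x) {N : ℕ}
    (hN : 2 ≤ N) {c K d : ℝ} (hc : 1 < c) (hK : 0 < K) (hd : 0 < d) (hcd : c ^ (d / 2) = N)
    (hcard : ∀ n, ∀ m ≤ n, N ^ m ≤ ((Λ n).filter (· ≤ c ^ m * K)).card + 1) {z : ℝ → ℝ}
    (hz : ∀ σ, d < σ →
      Tendsto (fun n => ((Λ n).map (· ^ (-σ / 2))).sum) atTop (nhds (z σ))) (L : ℝ) :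
    ¬ Tendsto z (nhdsWithin d (Set.Ioi d)) (nhds L) := by
  intro hL
  have hc0 : 0 < c := by linarith
  have hcount : ∀ x > 0, ∃ Q : ℝ, ∀ᶠ n in atTop, (((Λ n).filter (· ≤ x)).card : ℝ) ≤ Q := by
    intro x hx
    refine ⟨(z (d + 1) + 1) / x ^ (-(d + 1) / 2), ?_⟩
    filter_upwards [(hz (d + 1) (by linarith)).eventually_le_const
      (by linarith : z (d + 1) < z (d + 1) + 1)] with n hn
    rw [le_div_iff₀ (Real.rpow_pos_of_pos hx _)]
    refine le_trans (card_mul_rpow_le_sum (fun y hy => hpos n y (Multiset.mem_filter.1 hy).1)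
      (by linarith) fun y hy => (Multiset.mem_filter.1 hy).2) ?_
    exact (sum_filter_rpow_le (hpos n) _ _).trans hn
  set κ := K ^ (-d / 2) / 2 with hκ
  have hκ0 : 0 < κ := by positivity
  have hlow : ∀ J : ℕ, ∃ x > 0, ∀ᶠ n in atTop,
      J * κ ≤ (((Λ n).filter (· ≤ x)).map (· ^ (-d / 2))).sum := by
    intro J
    induction J with
    | zero =>
      refine ⟨1, one_pos, Eventually.of_forall fun n => ?_⟩
      rw [Nat.cast_zero, zero_mul]
      refine Multiset.sum_nonneg fun y hy => ?_
      obtain ⟨x, hx, rfl⟩ := Multiset.mem_map.1 hy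
      exact Real.rpow_nonneg (hpos n x (Multiset.mem_filter.1 hx).1).le _
    | succ J ih =>
      obtain ⟨x, hx, hxn⟩ := ih
      obtain ⟨Q, hQ⟩ := hcount x hx
      have hN1 : (1 : ℝ) < N := by exact_mod_cast hN
      obtain ⟨m, hm1, hm2⟩ := (((tendsto_pow_atTop_atTop_of_one_lt hN1).eventually_ge_atTop
        (2 * (Q + 1))).and ((tendsto_pow_atTop_atTop_of_one_lt hc).eventually_ge_atTop
        (x / K))).exists
      have hxK : x ≤ c ^ m * K := (div_le_iff₀ hK).1 hm2
      have hNm : (0 : ℝ) < (N : ℝ) ^ m := by positivity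
      refine ⟨c ^ m * K, by positivity, ?_⟩
      filter_upwards [hxn, hQ, eventually_ge_atTop m] with n h1 h2 h3
      have h4 : ((N : ℝ) ^ m) ≤ ((Λ n).filter (· ≤ c ^ m * K)).card + 1 := by
        exact_mod_cast hcard n m h3
      set S := (Λ n).filter (· ≤ c ^ m * K)
      have hSx : S.filter (· ≤ x) = (Λ n).filter (· ≤ x) := by
        rw [Multiset.filter_filter]
        exact Multiset.filter_congr fun y _ => ⟨fun h => h.1, fun h => ⟨h, h.trans hxK⟩⟩
      have hsplit := Multiset.filter_add_not (· ≤ x) S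
      rw [hSx] at hsplit
      have hcardS := congrArg (fun s => (Multiset.card s : ℝ)) hsplit
      simp only [Multiset.card_add, Nat.cast_add] at hcardS
      rw [← hsplit, Multiset.map_add, Multiset.sum_add]
      have h5 := card_mul_rpow_le_sum (s := S.filter fun y => ¬ y ≤ x) (X := c ^ m * K)
        (t := -d / 2)
        (fun y hy => hpos n y (Multiset.mem_filter.1 (Multiset.mem_filter.1 hy).1).1)
        (by linarith) fun y hy => (Multiset.mem_filter.1 (Multiset.mem_filter.1 hy).1).2
      have h6 : (c ^ m * K) ^ (-d / 2) = ((N : ℝ) ^ m)⁻¹ * (2 * κ) := by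
        rw [Real.mul_rpow (by positivity) hK.le, hκ, neg_div, Real.rpow_neg (by positivity),
          ← Real.rpow_natCast, ← Real.rpow_mul hc0.le, mul_comm (m : ℝ), Real.rpow_mul hc0.le,
          hcd, Real.rpow_natCast]
        ring
      rw [h6] at h5
      have h7 : κ ≤ ((S.filter fun y => ¬ y ≤ x).card : ℝ) * (((N : ℝ) ^ m)⁻¹ * (2 * κ)) := by
        have h8 : (N : ℝ) ^ m / 2 ≤ ((S.filter fun y => ¬ y ≤ x).card : ℝ) := by linarith
        calc κ = (N : ℝ) ^ m / 2 * (((N : ℝ) ^ m)⁻¹ * (2 * κ)) := by field_simp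
          _ ≤ _ := mul_le_mul_of_nonneg_right h8 (by positivity)
      push_cast
      linarith
  have hLge : ∀ J : ℕ, J * κ ≤ L := by
    intro J
    obtain ⟨x, hx, hxn⟩ := hlow J
    have hzσ : ∀ σ, d < σ → x ^ (-(σ - d) / 2) * (J * κ) ≤ z σ := by
      intro σ hσ
      refine ge_of_tendsto (hz σ hσ) ?_
      filter_upwards [hxn] with n hn
      refine le_trans ?_ (sum_filter_rpow_le (hpos n) (· ≤ x) _)
      refine (mul_le_mul_of_nonneg_left hn (Real.rpow_nonneg hx.le _)).trans ?_
      rw [← Multiset.sum_map_mul_left]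
      refine Multiset.sum_map_le_sum_map _ _ fun y hy => ?_
      obtain ⟨hy1, hy2⟩ := Multiset.mem_filter.1 hy
      have hy0 := hpos n y hy1
      have e : y ^ (-σ / 2) = y ^ (-(σ - d) / 2) * y ^ (-d / 2) := by
        rw [← Real.rpow_add hy0]; ring_nf
      rw [e]
      exact mul_le_mul_of_nonneg_right (Real.rpow_le_rpow_of_nonpos hy0 hy2 (by linarith))
        (Real.rpow_nonneg hy0.le _)
    have hlim : Tendsto (fun σ : ℝ => x ^ (-(σ - d) / 2) * (J * κ))
        (nhdsWithin d (Set.Ioi d)) (nhds (J * κ)) := by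
      have hcont : Continuous fun σ : ℝ => x ^ (-(σ - d) / 2) * (J * κ) :=
        (Real.continuous_const_rpow hx.ne').comp (by fun_prop) |>.mul continuous_const
      simpa using (hcont.tendsto d).mono_left nhdsWithin_le_nhds
    exact le_of_tendsto_of_tendsto hlim hL (eventually_nhdsWithin_of_forall hzσ)
  obtain ⟨J, hJ⟩ := exists_nat_gt (L / κ)
  exact absurd (hLge J) (not_le.2 ((div_lt_iff₀ hκ0).1 hJ))

lemma zetaPartial_ofReal {R : ℝ[X]} {a c : ℝ} (hc : 0 < c)
    (hinv : ∀ z : ℂ, memIcc a (aeval z R) → memIcc a z) {y : ℝ} (hy : y ∈ Set.Icc 0 a)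
    (n : ℕ) (σ : ℝ) :
    zetaPartial R c y n σ = (((scaledPreimages R c y n).map (· ^ (-σ / 2))).sum : ℝ) := by
  have hmem : ∀ w ∈ preimageRoots R y n, memIcc a w := fun w hw =>
    memIcc_of_mem_preimageRoots hinv hy hw
  rw [zetaPartial, scaledPreimages]
  generalize preimageRoots R y n = s at hmem ⊢
  induction s using Multiset.induction_on with
  | empty => simp
  | cons w s ih =>
    have hw := hmem w (Multiset.mem_cons_self w s)
    rw [Multiset.map_cons, Multiset.sum_cons,
      ih fun v hv => hmem v (Multiset.mem_cons_of_mem hv)]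
    by_cases h : 0 < w.re
    · have hw0 : w ≠ 0 := fun h0 => by simp [h0] at h
      have e : ((c : ℂ) ^ n * w) ^ (-(σ : ℂ) / 2) = ((c ^ n * w.re) ^ (-σ / 2) : ℝ) := by
        rw [Complex.ofReal_cpow (by positivity)]
        push_cast
        rw [hw.ofReal_re]
      rw [if_neg hw0, e, Multiset.filter_cons_of_pos (p := fun w : ℂ => 0 < w.re) _ h]
      simp
    · have hw0 : w = 0 := by
        rw [← hw.ofReal_re, le_antisymm (not_lt.1 h) hw.2.1, Complex.ofReal_zero]
      rw [if_pos hw0, zero_add, Multiset.filter_cons_of_neg (p := fun w : ℂ => 0 < w.re) _ h]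

theorem zeta_of_polynomial_pole_at_dR
    (R : Polynomial ℝ) (N : ℕ) (hN : R.natDegree = N) (hN2 : 2 ≤ N)
    (hR0 : R.eval 0 = 0) (c : ℝ) (hc : R.derivative.eval 0 = c) (hc1 : 1 < c)
    (a : ℝ) (ha : 0 < a)
    (hinv : ∀ z : ℂ, memIcc a (Polynomial.aeval z R) → memIcc a z)
    (z₀ : ℝ) (hz₀ : z₀ ∈ Set.Icc 0 a)
    (zeta : ℂ → ℂ)
    (hzeta : ∀ s : ℂ, 2 * Real.log N / Real.log c < s.re →
      Filter.Tendsto (fun n => zetaPartial R c z₀ n s) Filter.atTop (nhds (zeta s))) :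
    ¬ ∃ U : Set ℂ, IsOpen U ∧ ((2 * Real.log N / Real.log c : ℝ) : ℂ) ∈ U ∧
        ∃ h : ℂ → ℂ, DifferentiableOn ℂ h U ∧
          ∀ s ∈ U, 2 * Real.log N / Real.log c < s.re → h s = zeta s := by
  rintro ⟨U, hU, hdU, h, hh, hhz⟩
  subst hN hc
  set c := R.derivative.eval 0
  have hc0 : 0 < c := by linarith
  have hlogc : 0 < Real.log c := Real.log_pos hc1
  have hlogN : 0 < Real.log R.natDegree := Real.log_pos (by exact_mod_cast hN2)
  set d := 2 * Real.log R.natDegree / Real.log c with hd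
  have hcd : c ^ (d / 2) = R.natDegree := by
    have e : Real.log c * (d / 2) = Real.log R.natDegree := by rw [hd]; field_simp
    rw [Real.rpow_def_of_pos hc0, e,
      Real.exp_log (by exact_mod_cast (by omega : 0 < R.natDegree))]
  obtain ⟨K, hK, hcard⟩ := exists_le_card_scaledPreimages hN2 hR0 hc1 ha hinv hz₀
  refine not_tendsto_of_card_ge (Λ := scaledPreimages R c z₀)
    (fun n x hx => pos_of_mem_scaledPreimages hc0 hx) hN2 hc1 hK (by positivity) hcd hcard
    (z := fun σ => (zeta σ).re) (fun σ hσ => ?_) (h d).re ?_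
  · have := (Complex.continuous_re.tendsto _).comp (hzeta σ (by simpa using hσ))
    simpa [Function.comp_def, zetaPartial_ofReal hc0 hinv hz₀] using this
  · have hcont : ContinuousAt (fun σ : ℝ => h σ) d :=
      ContinuousAt.comp (f := fun σ : ℝ => (σ : ℂ))
        (hh.continuousOn.continuousAt (hU.mem_nhds hdU)) Complex.continuous_ofReal.continuousAt
    have hlim := ((Complex.continuous_re.tendsto _).comp hcont.tendsto).mono_left
      (nhdsWithin_le_nhds (s := Set.Ioi d))
    refine hlim.congr' ?_
    have hmem : ∀ᶠ σ : ℝ in nhds d, (σ : ℂ) ∈ U :=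
      Complex.continuous_ofReal.continuousAt.eventually (hU.mem_nhds hdU)
    filter_upwards [self_mem_nhdsWithin, hmem.filter_mono nhdsWithin_le_nhds] with σ hσ hσU
    simp [hhz σ hσU (by simpa using hσ)]
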